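/- For all finite simple graphs Γ_1 and Γ_2 each having at least one vertex, the chromatic number of their Cartesian (box) product equals the maximum of their chromatic numbers: χ(Γ_1 □ Γ_2) = max{χ(Γ_1), χ(Γ_2)}. -/

import Mathlib

namespace SimpleGraph

/-- Adding colorings of the two factors gives a coloring of the box product. -/
def Coloring.boxProd {V W α : Type*} {G : SimpleGraph V} {H : SimpleGraph W} [AddGroup α]
    (c : G.Coloring α) (d : H.Coloring α) : (G.boxProd H).Coloring α :=
  Coloring.mk (fun x ↦ c x.1 + d x.2) <| by
    rintro ⟨v, w⟩ ⟨v', w'⟩ h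
    rcases boxProd_adj.mp h with ⟨hv, rfl⟩ | ⟨hw, rfl⟩
    · exact fun e ↦ c.valid hv (add_right_cancel e)
    · exact fun e ↦ d.valid hw (add_left_cancel e)

theorem Colorable.boxProd {V W : Type*} {G : SimpleGraph V} {H : SimpleGraph W} {n : ℕ}
    (hG : G.Colorable n) (hH : H.Colorable n) : (G.boxProd H).Colorable n := by
  obtain ⟨c⟩ := hG
  obtain ⟨d⟩ := hH
  cases n with
  | zero => exact ⟨Coloring.mk (fun x ↦ c x.1) fun {x} _ ↦ (c x.1).elim0⟩
  | succ n => exact ⟨c.boxProd d⟩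

end SimpleGraph

/-- (Sabidussi.) For finite simple graphs `Γ₁` and `Γ₂`, each with at least one
vertex, the chromatic number of their Cartesian (box) product equals the maximum of
their chromatic numbers: `χ(Γ₁ □ Γ₂) = max {χ(Γ₁), χ(Γ₂)}`. -/
theorem chromaticNumber_boxProd {V₁ V₂ : Type*} [Fintype V₁] [Fintype V₂]
    [Nonempty V₁] [Nonempty V₂] (Γ₁ : SimpleGraph V₁) (Γ₂ : SimpleGraph V₂) :
    (Γ₁.boxProd Γ₂).chromaticNumber =
      max Γ₁.chromaticNumber Γ₂.chromaticNumber := by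
  apply le_antisymm
  · by_contra! hlt
    obtain ⟨n, hn⟩ := ENat.ne_top_iff_exists.mp hlt.ne_top
    have h := max_le_iff.mp hn.ge
    simp only [SimpleGraph.chromaticNumber_le_iff_colorable] at h
    exact ((h.1.boxProd h.2).chromaticNumber_le.trans hn.le).not_gt hlt
  · exact max_le
      (SimpleGraph.chromaticNumber_mono_of_hom
        (Γ₁.boxProdLeft Γ₂ (Classical.arbitrary V₂)).toHom)
      (SimpleGraph.chromaticNumber_mono_of_hom
        (Γ₁.boxProdRight Γ₂ (Classical.arbitrary V₁)).toHom)
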